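/- Let X be a second-countable locally compact Hausdorff space and let κ be a kernel on X satisfying (R1), (R2), (R3). Let A ⊂ X, A ≠ X, with cp_*A > 0, and let ω be a nonzero positive Radon measure with either I(ω) < ∞, or ω concentrated on X∖A and ω(X) < ∞. Then the inner balayage ω^A is uniquely determined within E'(A) by the symmetry relation: I(ω^A, λ) = I(λ^A, ω) for all λ ∈ E⁺, where λ^A denotes the unique measure in E'(A) with U^{λ^A} = U^λ nearly everywhere on A. -/

import Mathlib

open MeasureTheory Filter Set Topology ENNReal CompactlySupported UniformConvergence

namespace Balayage
open scoped Classical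

variable {X : Type*} [TopologicalSpace X] [MeasurableSpace X]

/-- A kernel: symmetric, lower semicontinuous, `[0,∞]`-valued. -/
structure IsKernel (κ : X → X → ℝ≥0∞) : Prop where
  symm : ∀ x y, κ x y = κ y x
  lsc : LowerSemicontinuous fun p : X × X => κ p.1 p.2

/-- The potential `U^μ(x) = ∫ κ(x,y) dμ(y)`. -/
noncomputable def potential (κ : X → X → ℝ≥0∞) (μ : Measure X) (x : X) : ℝ≥0∞ :=
  ∫⁻ y, κ x y ∂μ

/-- The mutual energy `I(μ,ν) = ∫∫ κ(x,y) dν(y) dμ(x)` of two positive measures. -/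
noncomputable def energy (κ : X → X → ℝ≥0∞) (μ ν : Measure X) : ℝ≥0∞ :=
  ∫⁻ x, potential κ ν x ∂μ

/-- A positive Radon measure (regular Borel measure, finite on compacts). -/
def IsRadon (μ : Measure X) : Prop := μ.Regular

/-- Finite energy: `I(μ) < ∞`. -/
def FiniteEnergy (κ : X → X → ℝ≥0∞) (μ : Measure X) : Prop := energy κ μ μ < ⊤

/-- Membership in the cone `E⁺` of positive Radon measures of finite energy. -/
def memE (κ : X → X → ℝ≥0∞) (μ : Measure X) : Prop := IsRadon μ ∧ FiniteEnergy κ μ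

/-- Membership in `E⁺(A)`: measures of `E⁺` concentrated on `A`
(i.e. the complement of `A` is negligible). -/
def memEOn (κ : X → X → ℝ≥0∞) (A : Set X) (μ : Measure X) : Prop :=
  memE κ μ ∧ μ Aᶜ = 0

/-- The strong (energy) distance `‖μ-ν‖ = √(I(μ)+I(ν)-2I(μ,ν))`. -/
noncomputable def sDist (κ : X → X → ℝ≥0∞) (μ ν : Measure X) : ℝ :=
  Real.sqrt ((energy κ μ μ).toReal + (energy κ ν ν).toReal - 2 * (energy κ μ ν).toReal)

/-- Membership in `E'(A)`, the strong closure of `E⁺(A)` in `E⁺`. -/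
def memEClos (κ : X → X → ℝ≥0∞) (A : Set X) (μ : Measure X) : Prop :=
  memE κ μ ∧ ∀ ε : ℝ, 0 < ε → ∃ ν, memEOn κ A ν ∧ sDist κ μ ν < ε

/-- The capacity of a compact set: the inverse of the minimal energy of
probability measures concentrated on it. -/
noncomputable def capC (κ : X → X → ℝ≥0∞) (K : Set X) : ℝ≥0∞ :=
  (⨅ (μ : Measure X) (_ : IsProbabilityMeasure μ) (_ : μ Kᶜ = 0), energy κ μ μ)⁻¹

/-- The inner capacity `cp_* A`: supremum of capacities of compact subsets. -/
noncomputable def innerCap (κ : X → X → ℝ≥0∞) (A : Set X) : ℝ≥0∞ :=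
  ⨆ (K : Set X) (_ : IsCompact K) (_ : K ⊆ A), capC κ K

/-- The outer capacity `cp^* A`: infimum of inner capacities of open supersets. -/
noncomputable def outerCap (κ : X → X → ℝ≥0∞) (A : Set X) : ℝ≥0∞ :=
  ⨅ (D : Set X) (_ : IsOpen D) (_ : A ⊆ D), innerCap κ D

/-- Strict positive definiteness (energy principle), stated for pairs of positive
measures of finite energy: `I(μ-ν) ≥ 0`, with equality only for `μ = ν`. -/
def StrictlyPosDef (κ : X → X → ℝ≥0∞) : Prop :=
  ∀ μ ν : Measure X, IsRadon μ → IsRadon ν → FiniteEnergy κ μ → FiniteEnergy κ ν →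
    (2 * energy κ μ ν ≤ energy κ μ μ + energy κ ν ν) ∧
    (2 * energy κ μ ν = energy κ μ μ + energy κ ν ν → μ = ν)

/-- Vague convergence of a sequence of measures: convergence of integrals of
continuous compactly supported functions. -/
def VagueTendsto (μ : ℕ → Measure X) (μ₀ : Measure X) : Prop :=
  ∀ f : X → ℝ, Continuous f → HasCompactSupport f →
    Tendsto (fun j => ∫ x, f x ∂(μ j)) atTop (nhds (∫ x, f x ∂μ₀))

/-- A perfect kernel: strictly positive definite, `E⁺` strongly complete, and the strong
topology on `E⁺` finer than the vague topology (sequential formulation; sequences suffice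
on second-countable spaces). -/
structure Perfect (κ : X → X → ℝ≥0∞) : Prop where
  posdef : StrictlyPosDef κ
  complete : ∀ μ : ℕ → Measure X, (∀ j, memE κ (μ j)) →
    (∀ ε : ℝ, 0 < ε → ∃ N, ∀ m ≥ N, ∀ n ≥ N, sDist κ (μ m) (μ n) < ε) →
    ∃ μ₀, memE κ μ₀ ∧ Tendsto (fun j => sDist κ (μ j) μ₀) atTop (nhds 0)
  finerThanVague : ∀ (μ : ℕ → Measure X) (μ₀ : Measure X), (∀ j, memE κ (μ j)) →
    memE κ μ₀ → Tendsto (fun j => sDist κ (μ j) μ₀) atTop (nhds 0) → VagueTendsto μ μ₀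

/-- The domination principle. -/
def Domination (κ : X → X → ℝ≥0∞) : Prop :=
  ∀ μ ν : Measure X, memE κ μ → IsRadon ν →
    (∀ᵐ x ∂μ, potential κ μ x ≤ potential κ ν x) → ∀ x, potential κ μ x ≤ potential κ ν x

/-- `h`-Ugaheri's maximum principle; for `h = 1` this is Frostman's maximum principle. -/
def Ugaheri (κ : X → X → ℝ≥0∞) (h : ℝ) : Prop :=
  ∀ μ : Measure X, memE κ μ → ∀ c : ℝ, 0 < c →
    (∀ᵐ x ∂μ, potential κ μ x ≤ ENNReal.ofReal c) →
    ∀ x, potential κ μ x ≤ ENNReal.ofReal (h * c)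

/-- Condition (R1): the kernel is perfect and satisfies the domination and
`h`-Ugaheri maximum principles for some `h ∈ [1, ∞)`. -/
structure R1 (κ : X → X → ℝ≥0∞) : Prop where
  perfect : Perfect κ
  domination : Domination κ
  ugaheri : ∃ h : ℝ, 1 ≤ h ∧ Ugaheri κ h

/-- Condition (R2): `κ(x,y)` is continuous and finite off the diagonal. -/
def R2 (κ : X → X → ℝ≥0∞) : Prop :=
  ContinuousOn (fun p : X × X => κ p.1 p.2) {p : X × X | p.1 ≠ p.2} ∧
    ∀ x y : X, x ≠ y → κ x y ≠ ⊤

/-- Condition (R3): `κ(·,y) → 0` uniformly on compact sets as `y` tends to the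
Alexandroff point of `X`. -/
def R3 (κ : X → X → ℝ≥0∞) : Prop :=
  ∀ K : Set X, IsCompact K → ∀ ε : ℝ≥0∞, 0 < ε →
    ∃ K' : Set X, IsCompact K' ∧ ∀ y ∉ K', ∀ x ∈ K, κ x y < ε

/-- `μA` is the inner balayage of `ω` onto `A`: it belongs to `E'(A)` and its potential
coincides with that of `ω` nearly everywhere on `A` (up to a set of inner capacity zero). -/
def IsInnerBalayage (κ : X → X → ℝ≥0∞) (A : Set X) (ω μA : Measure X) : Prop :=
  memEClos κ A μA ∧ innerCap κ {x ∈ A | potential κ μA x ≠ potential κ ω x} = 0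

/-- `μA` is the outer balayage of `ω` onto `A`: it belongs to `E'(A)` and its potential
coincides with that of `ω` quasi-everywhere on `A` (up to a set of outer capacity zero). -/
def IsOuterBalayage (κ : X → X → ℝ≥0∞) (A : Set X) (ω μA : Measure X) : Prop :=
  memEClos κ A μA ∧ outerCap κ {x ∈ A | potential κ μA x ≠ potential κ ω x} = 0

/-- Membership in the class `Γ_{A,ω}` of positive finite-energy Radon measures whose
potential dominates that of `ω` nearly everywhere on `A`. -/
def memGamma (κ : X → X → ℝ≥0∞) (A : Set X) (ω ν : Measure X) : Prop :=
  memE κ ν ∧ innerCap κ {x ∈ A | ¬ potential κ ω x ≤ potential κ ν x} = 0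

section Aux

set_option linter.all false
set_option linter.unusedSectionVars false
set_option linter.style.haveILetI false

variable [T2Space X] [LocallyCompactSpace X] [SecondCountableTopology X] [BorelSpace X]
variable {κ : X → X → ℝ≥0∞}

lemma isRadon_of_finiteOnCompacts (μ : Measure X) [IsFiniteMeasureOnCompacts μ] : IsRadon μ := by
  letI := TopologicalSpace.metrizableSpaceMetric X
  haveI : IsLocallyFiniteMeasure μ := isLocallyFiniteMeasure_of_isFiniteMeasureOnCompacts
  exact (inferInstance : μ.Regular)

lemma isRadon_of_le {μ ν : Measure X} (hν : IsRadon ν) (h : μ ≤ ν) : IsRadon μ := by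
  haveI : ν.Regular := hν
  haveI : IsFiniteMeasureOnCompacts μ :=
    ⟨fun K hK => (h K).trans_lt hK.measure_lt_top⟩
  exact isRadon_of_finiteOnCompacts μ

lemma IsRadon.add {μ ν : Measure X} (hμ : IsRadon μ) (hν : IsRadon ν) : IsRadon (μ + ν) := by
  haveI : μ.Regular := hμ
  haveI : ν.Regular := hν
  haveI : IsFiniteMeasureOnCompacts (μ + ν) :=
    ⟨fun K hK => by
      simpa using ⟨hK.measure_lt_top (μ := μ), hK.measure_lt_top (μ := ν)⟩⟩
  exact isRadon_of_finiteOnCompacts _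

lemma IsRadon.smul {μ : Measure X} (hμ : IsRadon μ) {c : ℝ≥0∞} (hc : c ≠ ⊤) :
    IsRadon (c • μ) := by
  haveI : μ.Regular := hμ
  exact Measure.Regular.smul hc

lemma IsRadon.sFinite {μ : Measure X} (hμ : IsRadon μ) : SigmaFinite μ := by
  haveI : μ.Regular := hμ
  haveI : IsLocallyFiniteMeasure μ := isLocallyFiniteMeasure_of_isFiniteMeasureOnCompacts
  infer_instance

lemma IsKernel.measurable (hκ : IsKernel κ) : Measurable (fun p : X × X => κ p.1 p.2) :=
  hκ.lsc.measurable

lemma measurable_potential (hκ : IsKernel κ) {μ : Measure X} (hμ : IsRadon μ) :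
    Measurable (potential κ μ) := by
  haveI := hμ.sFinite
  exact Measurable.lintegral_prod_right' hκ.measurable

lemma energy_comm (hκ : IsKernel κ) {μ ν : Measure X} (hμ : IsRadon μ) (hν : IsRadon ν) :
    energy κ μ ν = energy κ ν μ := by
  haveI := hμ.sFinite
  haveI := hν.sFinite
  unfold energy potential
  rw [lintegral_lintegral_swap hκ.measurable.aemeasurable]
  simp only [hκ.symm]

lemma energy_add_left (μ ν ρ : Measure X) :
    energy κ (μ + ν) ρ = energy κ μ ρ + energy κ ν ρ := by
  simp [energy, lintegral_add_measure]

lemma energy_smul_left (c : ℝ≥0∞) (μ ρ : Measure X) :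
    energy κ (c • μ) ρ = c * energy κ μ ρ := by
  simp [energy, lintegral_smul_measure]

lemma energy_add_right (hκ : IsKernel κ) {μ ν ρ : Measure X} (hμ : IsRadon μ) (hν : IsRadon ν)
    (hρ : IsRadon ρ) : energy κ ρ (μ + ν) = energy κ ρ μ + energy κ ρ ν := by
  rw [energy_comm hκ hρ (hμ.add hν), energy_add_left, energy_comm hκ hμ hρ, energy_comm hκ hν hρ]

lemma energy_smul_right (hκ : IsKernel κ) {c : ℝ≥0∞} (hc : c ≠ ⊤) {μ ρ : Measure X}
    (hμ : IsRadon μ) (hρ : IsRadon ρ) : energy κ ρ (c • μ) = c * energy κ ρ μ := by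
  rw [energy_comm hκ hρ (hμ.smul hc), energy_smul_left, energy_comm hκ hμ hρ]

lemma energy_mono_left {μ ν : Measure X} (h : μ ≤ ν) (ρ : Measure X) :
    energy κ μ ρ ≤ energy κ ν ρ := lintegral_mono' h le_rfl

lemma energy_mono {μ ν μ' ν' : Measure X} (h : μ ≤ ν) (h' : μ' ≤ ν') :
    energy κ μ μ' ≤ energy κ ν ν' :=
  lintegral_mono' h (fun _ => lintegral_mono' h' le_rfl)

lemma energy_lt_top (hp : StrictlyPosDef κ) {μ ν : Measure X} (hμ : memE κ μ) (hν : memE κ ν) :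
    energy κ μ ν < ⊤ := by
  have h := (hp μ ν hμ.1 hν.1 hμ.2 hν.2).1
  have h2 : 2 * energy κ μ ν < ⊤ := h.trans_lt (ENNReal.add_lt_top.2 ⟨hμ.2, hν.2⟩)
  refine lt_of_le_of_lt ?_ h2
  rw [two_mul]; exact le_self_add

lemma memE.of_le {μ ν : Measure X} (hν : memE κ ν) (h : μ ≤ ν) : memE κ μ :=
  ⟨isRadon_of_le hν.1 h, (energy_mono h h).trans_lt hν.2⟩

lemma memE.add (hκ : IsKernel κ) (hp : StrictlyPosDef κ) {μ ν : Measure X}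
    (hμ : memE κ μ) (hν : memE κ ν) : memE κ (μ + ν) := by
  refine ⟨hμ.1.add hν.1, ?_⟩
  unfold FiniteEnergy
  rw [energy_add_left, energy_add_right hκ hμ.1 hν.1 hμ.1, energy_add_right hκ hμ.1 hν.1 hν.1]
  simp [energy_lt_top hp hμ hν, energy_lt_top hp hν hμ, energy_lt_top hp hμ hμ,
    energy_lt_top hp hν hν]

lemma memE.smul (hκ : IsKernel κ) {μ : Measure X}
    (hμ : memE κ μ) {c : ℝ≥0∞} (hc : c ≠ ⊤) : memE κ (c • μ) := by
  refine ⟨hμ.1.smul hc, ?_⟩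
  unfold FiniteEnergy
  rw [energy_smul_left, energy_smul_right hκ hc hμ.1 hμ.1]
  exact ENNReal.mul_lt_top hc.lt_top (ENNReal.mul_lt_top hc.lt_top hμ.2)

/-- Real-valued mutual energy. -/
noncomputable def en (κ : X → X → ℝ≥0∞) (μ ν : Measure X) : ℝ := (energy κ μ ν).toReal

/-- Squared strong distance. -/
noncomputable def sq (κ : X → X → ℝ≥0∞) (μ ν : Measure X) : ℝ :=
  en κ μ μ + en κ ν ν - 2 * en κ μ ν

lemma sDist_eq (μ ν : Measure X) : sDist κ μ ν = Real.sqrt (sq κ μ ν) := rfl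

lemma en_comm (hκ : IsKernel κ) {μ ν : Measure X} (hμ : memE κ μ) (hν : memE κ ν) :
    en κ μ ν = en κ ν μ := by rw [en, en, energy_comm hκ hμ.1 hν.1]

lemma en_add_left (hp : StrictlyPosDef κ) {μ ν ρ : Measure X} (hμ : memE κ μ)
    (hν : memE κ ν) (hρ : memE κ ρ) : en κ (μ + ν) ρ = en κ μ ρ + en κ ν ρ := by
  rw [en, energy_add_left, ENNReal.toReal_add (energy_lt_top hp hμ hρ).ne
    (energy_lt_top hp hν hρ).ne]; rfl

lemma en_add_right (hκ : IsKernel κ) (hp : StrictlyPosDef κ) {μ ν ρ : Measure X} (hμ : memE κ μ)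
    (hν : memE κ ν) (hρ : memE κ ρ) : en κ ρ (μ + ν) = en κ ρ μ + en κ ρ ν := by
  rw [en_comm hκ hρ (hμ.add hκ hp hν), en_add_left hp hμ hν hρ, en_comm hκ hμ hρ,
    en_comm hκ hν hρ]

lemma en_smul_left {c : ℝ} (hc : 0 ≤ c) (μ ρ : Measure X) :
    en κ (ENNReal.ofReal c • μ) ρ = c * en κ μ ρ := by
  rw [en, energy_smul_left, ENNReal.toReal_mul, ENNReal.toReal_ofReal hc]; rfl

lemma en_smul_right (hκ : IsKernel κ) {c : ℝ} (hc : 0 ≤ c) {μ ρ : Measure X} (hμ : memE κ μ)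
    (hρ : memE κ ρ) : en κ ρ (ENNReal.ofReal c • μ) = c * en κ ρ μ := by
  rw [en_comm hκ hρ (hμ.smul hκ ENNReal.ofReal_ne_top), en_smul_left hc, en_comm hκ hμ hρ]

lemma sq_nonneg' (hp : StrictlyPosDef κ) {μ ν : Measure X} (hμ : memE κ μ) (hν : memE κ ν) :
    0 ≤ sq κ μ ν := by
  have h := (hp μ ν hμ.1 hν.1 hμ.2 hν.2).1
  have h2 := ENNReal.toReal_mono (ENNReal.add_lt_top.2 ⟨hμ.2, hν.2⟩).ne h
  rw [ENNReal.toReal_add hμ.2.ne hν.2.ne, ENNReal.toReal_mul] at h2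
  simp only [ENNReal.toReal_ofNat] at h2
  unfold sq en
  linarith

lemma eq_of_sq_eq_zero (hp : StrictlyPosDef κ) {μ ν : Measure X} (hμ : memE κ μ)
    (hν : memE κ ν) (h : sq κ μ ν = 0) : μ = ν := by
  refine (hp μ ν hμ.1 hν.1 hμ.2 hν.2).2 ?_
  have hf := energy_lt_top hp hμ hν
  rw [← ENNReal.toReal_eq_toReal_iff' (ENNReal.mul_lt_top (by simp) hf).ne
    (ENNReal.add_lt_top.2 ⟨hμ.2, hν.2⟩).ne, ENNReal.toReal_add hμ.2.ne hν.2.ne,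
    ENNReal.toReal_mul]
  simp only [ENNReal.toReal_ofNat]
  unfold sq en at h
  linarith

/-- Expansion along a ray. -/
lemma sq_add_smul (hκ : IsKernel κ) (hp : StrictlyPosDef κ) {μ ν ρ : Measure X} (hμ : memE κ μ)
    (hν : memE κ ν) (hρ : memE κ ρ) {t : ℝ} (ht : 0 ≤ t) :
    sq κ ν (μ + ENNReal.ofReal t • ρ) =
      sq κ ν μ + 2 * t * (en κ μ ρ - en κ ν ρ) + t ^ 2 * en κ ρ ρ := by
  have hs : memE κ (ENNReal.ofReal t • ρ) := hρ.smul hκ ENNReal.ofReal_ne_top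
  unfold sq
  rw [en_add_left hp hμ hs (hμ.add hκ hp hs), en_add_right hκ hp hμ hs hμ,
    en_add_right hκ hp hμ hs hs, en_add_right hκ hp hμ hs hν, en_smul_left ht, en_smul_left ht,
    en_smul_right hκ ht hρ hμ, en_smul_right hκ ht hρ hρ, en_smul_right hκ ht hρ hν,
    en_comm hκ hρ hμ]
  ring

lemma sq_comm (hκ : IsKernel κ) {μ ν : Measure X} (hμ : memE κ μ) (hν : memE κ ν) :
    sq κ μ ν = sq κ ν μ := by
  unfold sq; rw [en_comm hκ hμ hν]; ring

/-- Cauchy-Schwarz. -/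
lemma cauchy_schwarz (hκ : IsKernel κ) (hp : StrictlyPosDef κ) {μ ν ρ : Measure X}
    (hμ : memE κ μ) (hν : memE κ ν) (hρ : memE κ ρ) :
    (en κ μ ρ - en κ ν ρ) ^ 2 ≤ sq κ μ ν * en κ ρ ρ := by
  have key : ∀ t : ℝ, 0 ≤ en κ ρ ρ * (t * t) + (2 * (en κ μ ρ - en κ ν ρ)) * t + sq κ μ ν := by
    intro t
    rcases le_total 0 t with ht | ht
    · have h := sq_nonneg' hp hν (hμ.add hκ hp (hρ.smul hκ (ENNReal.ofReal_ne_top (r := t))))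
      rw [sq_add_smul hκ hp hμ hν hρ ht, sq_comm hκ hν hμ] at h
      linarith
    · have h := sq_nonneg' hp hμ (hν.add hκ hp (hρ.smul hκ (ENNReal.ofReal_ne_top (r := -t))))
      rw [sq_add_smul hκ hp hν hμ hρ (by linarith)] at h
      linarith
  have := discrim_le_zero key
  unfold discrim at this
  linarith

lemma tendsto_en (hκ : IsKernel κ) (hp : StrictlyPosDef κ) {s : ℕ → Measure X} {μ ρ : Measure X}
    (hs : ∀ j, memE κ (s j)) (hμ : memE κ μ) (hρ : memE κ ρ)
    (h : Tendsto (fun j => sq κ (s j) μ) atTop (𝓝 0)) :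
    Tendsto (fun j => en κ (s j) ρ) atTop (𝓝 (en κ μ ρ)) := by
  have h1 : Tendsto (fun j => sq κ (s j) μ * en κ ρ ρ) atTop (𝓝 0) := by
    simpa using h.mul_const (en κ ρ ρ)
  have h2 : Tendsto (fun j => (en κ (s j) ρ - en κ μ ρ) ^ 2) atTop (𝓝 0) :=
    squeeze_zero (fun _ => sq_nonneg _) (fun j => cauchy_schwarz hκ hp (hs j) hμ hρ) h1
  have h3 := h2.sqrt
  simp only [Real.sqrt_sq_eq_abs, Real.sqrt_zero] at h3
  rw [tendsto_iff_dist_tendsto_zero]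
  simpa [Real.dist_eq] using h3

lemma tendsto_en_self (hκ : IsKernel κ) (hp : StrictlyPosDef κ) {s : ℕ → Measure X}
    {μ : Measure X} (hs : ∀ j, memE κ (s j)) (hμ : memE κ μ)
    (h : Tendsto (fun j => sq κ (s j) μ) atTop (𝓝 0)) :
    Tendsto (fun j => en κ (s j) (s j)) atTop (𝓝 (en κ μ μ)) := by
  have h1 := tendsto_en hκ hp hs hμ hμ h
  have h2 := (h.add (h1.const_mul 2)).sub_const (en κ μ μ)
  refine (h2.congr fun j => ?_).trans_eq ?_
  · unfold sq; ring
  · congr 1; ring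

lemma sDist_tendsto_iff (hp : StrictlyPosDef κ) {s : ℕ → Measure X} {μ : Measure X}
    (hs : ∀ j, memE κ (s j)) (hμ : memE κ μ) :
    Tendsto (fun j => sDist κ (s j) μ) atTop (𝓝 0) ↔
      Tendsto (fun j => sq κ (s j) μ) atTop (𝓝 0) := by
  constructor
  · intro h
    have := h.pow 2
    refine (this.congr fun j => ?_).trans_eq (by simp)
    rw [sDist_eq, Real.sq_sqrt (sq_nonneg' hp (hs j) hμ)]
  · intro h
    have := h.sqrt
    simpa [sDist_eq] using this

lemma vague_open {s : ℕ → Measure X} {μ : Measure X} (hs : ∀ j, IsRadon (s j)) (hμ : IsRadon μ)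
    (h : VagueTendsto s μ) {U : Set X} (hU : IsOpen U) :
    μ U ≤ liminf (fun j => s j U) atTop := by
  haveI : μ.Regular := hμ
  haveI : ∀ j, (s j).Regular := hs
  refine le_of_forall_lt fun r hr => ?_
  obtain ⟨C, hCU, hC, hrC⟩ := hU.exists_lt_isCompact hr
  refine hrC.trans_le ?_
  obtain ⟨f, hf1, hf0, hfc, hf01⟩ := exists_continuous_one_zero_of_isCompact hC hU.isClosed_compl
    (Set.disjoint_compl_right_iff_subset.2 hCU)
  have hint : ∀ ν : Measure X, ν.Regular → Integrable (fun x => f x) ν := fun ν _ =>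
    f.continuous.integrable_of_hasCompactSupport hfc
  have hlim := (ENNReal.continuous_ofReal.tendsto _).comp (h f f.continuous hfc)
  have e : ∀ ν : Measure X, ν.Regular →
      ENNReal.ofReal (∫ x, f x ∂ν) = ∫⁻ x, ENNReal.ofReal (f x) ∂ν := fun ν hν =>
    ofReal_integral_eq_lintegral_ofReal (hint ν hν) (ae_of_all _ fun x => (hf01 x).1)
  have h1 : μ C ≤ ENNReal.ofReal (∫ x, f x ∂μ) := by
    rw [e μ hμ, ← lintegral_indicator_one hC.measurableSet]
    refine lintegral_mono fun x => ?_
    by_cases hx : x ∈ C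
    · simp [hx, hf1 hx]
    · simp [hx]
  refine h1.trans ?_
  rw [← hlim.liminf_eq]
  refine liminf_le_liminf (Eventually.of_forall fun j => ?_)
  simp only [Function.comp]
  rw [e _ (hs j), ← lintegral_indicator_one hU.measurableSet]
  refine lintegral_mono fun x => ?_
  by_cases hx : x ∈ U
  · simpa [hx] using (hf01 x).2
  · simp [hx, hf0 (show x ∈ Uᶜ from hx)]

lemma vague_lsc {s : ℕ → Measure X} {μ : Measure X} (hs : ∀ j, IsRadon (s j)) (hμ : IsRadon μ)
    (h : VagueTendsto s μ) {g : X → ℝ≥0∞} (hg : LowerSemicontinuous g) :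
    ∫⁻ x, g x ∂μ ≤ liminf (fun j => ∫⁻ x, g x ∂(s j)) atTop := by
  have hgm : Measurable g := hg.measurable
  have trunc : ∀ n : ℕ, ∫⁻ x, min (g x) n ∂μ ≤ liminf (fun j => ∫⁻ x, g x ∂(s j)) atTop := by
    intro n
    have hm : Measurable (fun x => (min (g x) n).toReal) :=
      (hgm.min measurable_const).ennreal_toReal
    have hfin : ∀ x, min (g x) (n : ℝ≥0∞) ≠ ⊤ := fun x =>
      ((min_le_right _ _).trans_lt (ENNReal.natCast_lt_top n)).ne
    have e : ∀ ν : Measure X, ∫⁻ x, min (g x) n ∂ν =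
        ∫⁻ t in Ioi (0:ℝ), ν {x | t < (min (g x) n).toReal} := by
      intro ν
      rw [← lintegral_eq_lintegral_meas_lt ν (ae_of_all _ fun _ => ENNReal.toReal_nonneg)
        hm.aemeasurable]
      exact lintegral_congr fun x => (ENNReal.ofReal_toReal (hfin x)).symm
    have hopen : ∀ t : ℝ, 0 < t → IsOpen {x | t < (min (g x) n).toReal} := by
      intro t ht
      have : {x | t < (min (g x) (n : ℝ≥0∞)).toReal} =
          {x | ENNReal.ofReal t < g x} ∩ {x | ENNReal.ofReal t < (n : ℝ≥0∞)} := by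
        ext x
        simp only [mem_setOf_eq, mem_inter_iff, ← lt_min_iff]
        exact (ENNReal.ofReal_lt_iff_lt_toReal ht.le (hfin x)).symm
      rw [this]
      exact (hg.isOpen_preimage _).inter isOpen_const
    rw [e μ]
    calc ∫⁻ t in Ioi (0:ℝ), μ {x | t < (min (g x) n).toReal}
        ≤ ∫⁻ t in Ioi (0:ℝ), liminf (fun j => s j {x | t < (min (g x) n).toReal}) atTop := by
          refine setLIntegral_mono' measurableSet_Ioi fun t ht => ?_
          exact vague_open hs hμ h (hopen t ht)
      _ ≤ liminf (fun j => ∫⁻ t in Ioi (0:ℝ), s j {x | t < (min (g x) n).toReal}) atTop := by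
          refine lintegral_liminf_le fun j => ?_
          refine Antitone.measurable fun a b hab => measure_mono fun x hx => ?_
          exact lt_of_le_of_lt hab hx
      _ ≤ liminf (fun j => ∫⁻ x, g x ∂(s j)) atTop := by
          refine liminf_le_liminf (Eventually.of_forall fun j => ?_)
          rw [← e]
          exact lintegral_mono fun x => min_le_left _ _
  have hsup : ∀ x, g x = ⨆ n : ℕ, min (g x) (n : ℝ≥0∞) := by
    intro x
    have : (⨆ n : ℕ, min (g x) (n : ℝ≥0∞)) = min (g x) (⨆ n : ℕ, (n : ℝ≥0∞)) :=
      (inf_iSup_eq _ _).symm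
    rw [this, ENNReal.iSup_natCast, min_eq_left le_top]
  have : ∫⁻ x, g x ∂μ = ⨆ n : ℕ, ∫⁻ x, min (g x) n ∂μ := by
    rw [← lintegral_iSup (fun n => hgm.min measurable_const)]
    · exact lintegral_congr hsup
    · intro m n hmn x
      exact min_le_min le_rfl (by exact_mod_cast hmn)
  rw [this]
  exact iSup_le trunc

lemma measure_zero_of_innerCap (hκ : IsKernel κ) {ν : Measure X} (hν : memE κ ν) {B : Set X}
    (hB : MeasurableSet B) (h0 : innerCap κ B = 0) : ν B = 0 := by
  by_contra hne
  haveI : ν.Regular := hν.1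
  haveI := hν.1.sFinite
  obtain ⟨K, hKB, hK, hpos⟩ := hB.exists_lt_isCompact (pos_iff_ne_zero.2 hne)
  have hKtop : ν K ≠ ⊤ := hK.measure_lt_top.ne
  have hc : capC κ K = 0 := by
    unfold innerCap at h0
    simp only [ENNReal.iSup_eq_zero] at h0
    exact h0 K hK hKB
  unfold capC at hc
  rw [ENNReal.inv_eq_zero] at hc
  simp only [iInf_eq_top] at hc
  have hinv : (ν K)⁻¹ ≠ ⊤ := ENNReal.inv_ne_top.2 hpos.ne'
  have hmem : memE κ ((ν K)⁻¹ • ν.restrict K) :=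
    (hν.of_le Measure.restrict_le_self).smul hκ hinv
  refine hmem.2.ne (hc _ ⟨?_⟩ ?_)
  · simp [ENNReal.inv_mul_cancel hpos.ne' hKtop]
  · simp [Measure.restrict_apply hK.measurableSet.compl]

lemma innerCap_mono {A B : Set X} (h : A ⊆ B) : innerCap κ A ≤ innerCap κ B := by
  unfold innerCap
  exact iSup_mono fun K => iSup_mono fun hK => iSup_mono' fun hKA => ⟨hKA.trans h, le_rfl⟩

lemma ae_not_of_innerCap (hκ : IsKernel κ) {A : Set X} {ν : Measure X} (hν : memEOn κ A ν)
    {P : X → Prop} (hP : MeasurableSet {x | P x}) (h0 : innerCap κ {x ∈ A | P x} = 0) :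
    ∀ᵐ x ∂ν, ¬ P x := by
  set T := toMeasurable ν Aᶜ with hT
  have hTm : MeasurableSet T := measurableSet_toMeasurable _ _
  have hT0 : ν T = 0 := by rw [hT, measure_toMeasurable, hν.2]
  have hsub : Tᶜ ∩ {x | P x} ⊆ {x ∈ A | P x} := by
    rintro x ⟨hx, hPx⟩
    refine ⟨?_, hPx⟩
    by_contra hxA
    exact hx (subset_toMeasurable ν Aᶜ hxA)
  have h1 : ν (Tᶜ ∩ {x | P x}) = 0 :=
    measure_zero_of_innerCap hκ hν.1 (hTm.compl.inter hP)
      (le_antisymm ((innerCap_mono hsub).trans h0.le) bot_le)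
  rw [ae_iff]
  refine measure_mono_null (t := T ∪ (Tᶜ ∩ {x | P x})) ?_ (measure_union_null hT0 h1)
  intro x hx
  simp only [not_not, mem_setOf_eq] at hx
  by_cases hxT : x ∈ T
  · exact Or.inl hxT
  · exact Or.inr ⟨hxT, hx⟩

/-- Potentials of a measure and its balayage agree almost everywhere for measures on `A`. -/
lemma ae_eq_of_bal (hκ : IsKernel κ) {A : Set X} {ν ω β : Measure X} (hν : memEOn κ A ν)
    (hω : IsRadon ω) (hβ : IsInnerBalayage κ A ω β) :
    ∀ᵐ x ∂ν, potential κ β x = potential κ ω x := by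
  have := ae_not_of_innerCap hκ hν (P := fun x => potential κ β x ≠ potential κ ω x)
    (measurableSet_eq_fun (measurable_potential hκ hβ.1.1.1) (measurable_potential hκ hω)).compl
    hβ.2
  filter_upwards [this] with x hx
  exact not_not.1 hx

lemma energy_eq_of_bal (hκ : IsKernel κ) {A : Set X} {ν ω β : Measure X} (hν : memEOn κ A ν)
    (hω : IsRadon ω) (hβ : IsInnerBalayage κ A ω β) : energy κ ν β = energy κ ν ω :=
  lintegral_congr_ae (ae_eq_of_bal hκ hν hω hβ)

/-- Existence of the projection onto the cone of measures carried by a closed set. -/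
lemma exists_proj (hκ : IsKernel κ) (hP : Perfect κ) {K : Set X} (hK : IsClosed K)
    {τ : Measure X} (hτ : memE κ τ) :
    ∃ σ, memEOn κ K σ ∧ ∀ ρ, memEOn κ K ρ → sq κ τ σ ≤ sq κ τ ρ := by
  have hp := hP.posdef
  let S : Set ℝ := {r | ∃ ρ, memEOn κ K ρ ∧ r = sq κ τ ρ}
  have hzero : memEOn κ K (0 : Measure X) := by
    refine ⟨⟨?_, ?_⟩, by simp⟩
    · exact isRadon_of_le hτ.1 (Measure.zero_le _)
    · simp [FiniteEnergy, energy]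
  have hSne : S.Nonempty := ⟨_, 0, hzero, rfl⟩
  have hSbdd : BddBelow S := by
    refine ⟨0, ?_⟩
    rintro r ⟨ρ, hρ, rfl⟩
    exact sq_nonneg' hp hτ hρ.1
  set d := sInf S with hd
  have hle : ∀ ρ, memEOn κ K ρ → d ≤ sq κ τ ρ := fun ρ hρ => csInf_le hSbdd ⟨ρ, hρ, rfl⟩
  have hex : ∀ j : ℕ, ∃ ρ, memEOn κ K ρ ∧ sq κ τ ρ < d + 1 / ((j : ℝ) + 1) := by
    intro j
    obtain ⟨r, ⟨ρ, hρ, rfl⟩, hr⟩ := exists_lt_of_csInf_lt hSne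
      (show sInf S < d + 1 / ((j : ℝ) + 1) from lt_add_of_pos_right _ (by positivity))
    exact ⟨ρ, hρ, hr⟩
  choose s hsK hsd using hex
  have hsE : ∀ j, memE κ (s j) := fun j => (hsK j).1
  have hhalf : (0:ℝ) ≤ 1 / 2 := by norm_num
  -- parallelogram
  have hpar : ∀ m n, sq κ (s m) (s n) < 2 / ((m : ℝ) + 1) + 2 / ((n : ℝ) + 1) := by
    intro m n
    have hmid : memEOn κ K (ENNReal.ofReal (1 / 2) • (s m + s n)) := by
      refine ⟨((hsE m).add hκ hp (hsE n)).smul hκ ENNReal.ofReal_ne_top, ?_⟩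
      simp [(hsK m).2, (hsK n).2]
    have h1 := hle _ hmid
    have hadd := (hsE m).add hκ hp (hsE n)
    have h2 : sq κ (s m) (s n) = 2 * sq κ τ (s m) + 2 * sq κ τ (s n)
        - 4 * sq κ τ (ENNReal.ofReal (1 / 2) • (s m + s n)) := by
      unfold sq
      rw [en_smul_left hhalf, en_smul_right hκ hhalf hadd hadd, en_smul_right hκ hhalf hadd hτ,
        en_add_left hp (hsE m) (hsE n) hadd, en_add_right hκ hp (hsE m) (hsE n) (hsE m),
        en_add_right hκ hp (hsE m) (hsE n) (hsE n), en_add_right hκ hp (hsE m) (hsE n) hτ,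
        en_comm hκ (hsE n) (hsE m)]
      ring
    have e1 := hsd m
    have e2 := hsd n
    have : 2 / ((m : ℝ) + 1) + 2 / ((n : ℝ) + 1) =
      2 * (1 / ((m : ℝ) + 1)) + 2 * (1 / ((n : ℝ) + 1)) := by ring
    rw [this]
    linarith
  obtain ⟨σ, hσ, hlim⟩ := hP.complete s hsE (by
    intro ε hε
    obtain ⟨N, hN⟩ := exists_nat_gt (4 / ε ^ 2)
    refine ⟨N, fun m hm n hn => ?_⟩
    rw [sDist_eq, Real.sqrt_lt' hε]
    refine (hpar m n).trans ?_
    have hN0 : (0:ℝ) < (N : ℝ) + 1 := by positivity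
    have hbd : ∀ k : ℕ, k ≥ N → 2 / ((k : ℝ) + 1) ≤ 2 / ((N : ℝ) + 1) := by
      intro k hk
      have : (N : ℝ) ≤ k := by exact_mod_cast hk
      gcongr
    have h4 : 4 / ((N : ℝ) + 1) < ε ^ 2 := by
      rw [div_lt_iff₀ (by positivity)] at hN ⊢
      nlinarith [sq_nonneg ε]
    have : 4 / ((N : ℝ) + 1) = 2 / ((N : ℝ) + 1) + 2 / ((N : ℝ) + 1) := by ring
    linarith [hbd m hm, hbd n hn])
  have hv := hP.finerThanVague s σ hsE hσ hlim
  have hσK : σ Kᶜ = 0 := by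
    have := vague_open (fun j => (hsE j).1) hσ.1 hv hK.isOpen_compl
    simpa [(hsK _).2] using this
  refine ⟨σ, ⟨hσ, hσK⟩, fun ρ hρ => ?_⟩
  refine le_trans ?_ (hle ρ hρ)
  have hsq := (sDist_tendsto_iff hp hsE hσ).1 hlim
  have t1 := tendsto_en_self hκ hp hsE hσ hsq
  have t2 := tendsto_en hκ hp hsE hσ hτ hsq
  have t3 : Tendsto (fun j => sq κ τ (s j)) atTop (𝓝 (sq κ τ σ)) := by
    unfold sq
    refine Tendsto.sub (t1.const_add _) (Tendsto.const_mul 2 ?_)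
    rw [en_comm hκ hτ hσ]
    exact t2.congr fun j => en_comm hκ (hsE j) hτ
  have t4 : Tendsto (fun j : ℕ => d + 1 / ((j : ℝ) + 1)) atTop (𝓝 (d + 0)) :=
    tendsto_one_div_add_atTop_nhds_zero_nat.const_add d
  rw [add_zero] at t4
  exact le_of_tendsto_of_tendsto' t3 t4 fun j => (hsd j).le

/-- The potential of the projection does not exceed the given one, almost everywhere. -/
lemma proj_ae_le (hκ : IsKernel κ) (hp : StrictlyPosDef κ) {K : Set X}
    {τ σ : Measure X} (hτ : memE κ τ) (hσ : memEOn κ K σ)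
    (hmin : ∀ ρ, memEOn κ K ρ → sq κ τ σ ≤ sq κ τ ρ) :
    ∀ᵐ x ∂σ, potential κ σ x ≤ potential κ τ x := by
  set B : Set X := {x | potential κ τ x < potential κ σ x} with hB
  have hmσ := measurable_potential hκ hσ.1.1
  have hmτ := measurable_potential hκ hτ.1
  have hBm : MeasurableSet B := measurableSet_lt hmτ hmσ
  set a := σ.restrict Bᶜ with ha
  set b := σ.restrict B with hb
  have hab : a + b = σ := by rw [ha, hb, add_comm]; exact Measure.restrict_add_restrict_compl hBm
  have haE : memE κ a := hσ.1.of_le Measure.restrict_le_self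
  have hbE : memE κ b := hσ.1.of_le Measure.restrict_le_self
  have haK : a Kᶜ = 0 := le_antisymm ((Measure.restrict_le_self _).trans hσ.2.le) bot_le
  have hbK : b Kᶜ = 0 := le_antisymm ((Measure.restrict_le_self _).trans hσ.2.le) bot_le
  have h1 : ∀ t : ℝ, 0 ≤ t → sq κ τ σ ≤
      sq κ τ a + 2 * t * (en κ a b - en κ τ b) + t ^ 2 * en κ b b := by
    intro t ht
    rw [← sq_add_smul hκ hp haE hτ hbE ht]
    refine hmin _ ⟨haE.add hκ hp (hbE.smul hκ ENNReal.ofReal_ne_top), ?_⟩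
    simp [haK, hbK]
  have h2 : sq κ τ σ = sq κ τ a + 2 * 1 * (en κ a b - en κ τ b) + 1 ^ 2 * en κ b b := by
    rw [← sq_add_smul hκ hp haE hτ hbE zero_le_one, ENNReal.ofReal_one, one_smul, hab]
  have h3 : en κ b σ ≤ en κ b τ := by
    have e1 : en κ b σ = en κ a b + en κ b b := by
      rw [← en_add_left hp haE hbE hbE, hab, en_comm hκ hbE hσ.1]
    rw [e1, en_comm hκ hbE hτ]
    have hb0 : 0 ≤ en κ b b := ENNReal.toReal_nonneg
    by_contra hcon
    push Not at hcon
    set c := en κ a b + en κ b b - en κ τ b with hc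
    have hc0 : 0 < c := by linarith
    -- take t = 1 - u
    have key : ∀ u : ℝ, u ≤ 1 → 0 ≤ u * (u * en κ b b - 2 * c) := by
      intro u hu
      have := h1 (1 - u) (by linarith)
      rw [h2] at this
      nlinarith
    have hu0 : 0 < min 1 (c / (en κ b b + 1)) := by positivity
    have hk := key _ (min_le_left 1 (c / (en κ b b + 1)))
    have hk2 := nonneg_of_mul_nonneg_right hk hu0
    have : min 1 (c / (en κ b b + 1)) * en κ b b ≤ c := by
      calc min 1 (c / (en κ b b + 1)) * en κ b b ≤ (c / (en κ b b + 1)) * en κ b b := by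
            gcongr; exact min_le_right _ _
        _ ≤ (c / (en κ b b + 1)) * (en κ b b + 1) := by gcongr; linarith
        _ = c := by field_simp
    linarith
  have h4 : energy κ b σ ≤ energy κ b τ :=
    (ENNReal.toReal_le_toReal (energy_lt_top hp hbE hσ.1).ne (energy_lt_top hp hbE hτ).ne).1 h3
  have h5 : ∀ᵐ x ∂b, potential κ τ x = potential κ σ x := by
    have hle : potential κ τ ≤ᵐ[b] potential κ σ := by
      filter_upwards [ae_restrict_mem hBm] with x hx
      exact le_of_lt hx
    exact ae_eq_of_ae_le_of_lintegral_le hle (energy_lt_top hp hbE hτ).ne hmσ.aemeasurable h4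
  have h6 : ∀ᵐ x ∂σ, x ∈ B → potential κ τ x = potential κ σ x := (ae_restrict_iff' hBm).1 h5
  filter_upwards [h6] with x hx
  by_contra hcon
  push Not at hcon
  exact hcon.ne (hx hcon)

/-- Approximation of the balayage from below by measures on compact subsets of `A`. -/
lemma exists_approx (hκ : IsKernel κ) (hR1 : R1 κ) {A : Set X} {ω β : Measure X}
    (hω : IsRadon ω) (hβ : IsInnerBalayage κ A ω β) {ε : ℝ} (hε : 0 < ε) :
    ∃ σ, memEOn κ A σ ∧ sq κ σ β < ε ∧ ∀ x, potential κ σ x ≤ potential κ ω x := by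
  have hP := hR1.perfect
  have hp := hP.posdef
  have hβE := hβ.1.1
  obtain ⟨ν, hν, hd⟩ := hβ.1.2 (Real.sqrt ε) (Real.sqrt_pos.2 hε)
  rw [sDist_eq, Real.sqrt_lt_sqrt_iff (sq_nonneg' hp hβE hν.1)] at hd
  -- compact exhaustion of ν
  haveI : ν.Regular := hν.1.1
  haveI := hν.1.1.sFinite
  set T := (toMeasurable ν Aᶜ)ᶜ with hT
  have hTm : MeasurableSet T := (measurableSet_toMeasurable _ _).compl
  have hT0 : ν Tᶜ = 0 := by rw [hT, compl_compl, measure_toMeasurable, hν.2]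
  have hTA : T ⊆ A := by
    intro x hx
    by_contra hxA
    exact hx (subset_toMeasurable ν Aᶜ hxA)
  have hint : energy κ ν β < ⊤ := energy_lt_top hp hν.1 hβE
  obtain ⟨F, hFc, hFT, hF⟩ : ∃ F : Set X, IsCompact F ∧ F ⊆ T ∧
      (en κ β β + en κ ν ν - ε) / 2 < en κ (ν.restrict F) β := by
    set r := (en κ β β + en κ ν ν - ε) / 2 with hrdef
    have hrlt : r < en κ ν β := by
      have := hd
      unfold sq at this
      rw [en_comm hκ hβE hν.1] at this
      rw [hrdef]; linarith
    rcases lt_or_ge r 0 with hr0 | hr0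
    · exact ⟨∅, isCompact_empty, empty_subset _, hr0.trans_le ENNReal.toReal_nonneg⟩
    · set η := ν.withDensity (potential κ β) with hη
      have hηu : η univ = energy κ ν β := by
        rw [hη, withDensity_apply _ MeasurableSet.univ, Measure.restrict_univ]; rfl
      haveI : IsFiniteMeasure η := ⟨by rw [hηu]; exact hint⟩
      have hηR : η.Regular := isRadon_of_finiteOnCompacts η
      have hηT : η T = energy κ ν β := by
        rw [hη, withDensity_apply _ hTm, Measure.restrict_eq_self_of_ae_mem (by
          rw [ae_iff]; exact hT0)]; rfl
      obtain ⟨F, hFT, hFc, hF⟩ := hTm.exists_lt_isCompact (μ := η) (r := ENNReal.ofReal r) (by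
        rw [hηT]
        exact (ENNReal.ofReal_lt_iff_lt_toReal hr0 hint.ne).2 hrlt)
      refine ⟨F, hFc, hFT, ?_⟩
      rw [hη, withDensity_apply _ hFc.measurableSet] at hF
      exact (ENNReal.ofReal_lt_iff_lt_toReal hr0
        ((energy_mono_left Measure.restrict_le_self β).trans_lt hint).ne).1 hF
  have hFm : MeasurableSet F := hFc.measurableSet
  have hr : memE κ (ν.restrict F) := hν.1.of_le Measure.restrict_le_self
  have hn : sq κ β (ν.restrict F) < ε := by
    unfold sq
    rw [en_comm hκ hβE hr]
    have : en κ (ν.restrict F) (ν.restrict F) ≤ en κ ν ν :=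
      ENNReal.toReal_mono hν.1.2.ne
        (energy_mono Measure.restrict_le_self Measure.restrict_le_self)
    linarith
  obtain ⟨σ, hσ, hmin⟩ := exists_proj hκ hP hFc.isClosed hβE
  have hσA : memEOn κ A σ :=
    ⟨hσ.1, measure_mono_null (compl_subset_compl.2 (hFT.trans hTA)) hσ.2⟩
  refine ⟨σ, hσA, ?_, ?_⟩
  · rw [sq_comm hκ hσ.1 hβE]
    refine (hmin _ ⟨hr, ?_⟩).trans_lt hn
    rw [Measure.restrict_apply hFm.compl]; simp
  · refine hR1.domination σ ω hσ.1 hω ?_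
    filter_upwards [proj_ae_le hκ hp hβE hσ hmin, ae_eq_of_bal hκ hσA hω hβ] with x h1 h2
    rwa [h2] at h1

lemma exists_seq (hκ : IsKernel κ) (hR1 : R1 κ) {A : Set X} {ω β : Measure X}
    (hω : IsRadon ω) (hβ : IsInnerBalayage κ A ω β) :
    ∃ s : ℕ → Measure X, (∀ j, memEOn κ A (s j)) ∧
      Tendsto (fun j => sq κ (s j) β) atTop (𝓝 0) ∧
      ∀ j x, potential κ (s j) x ≤ potential κ ω x := by
  have : ∀ j : ℕ, ∃ σ, memEOn κ A σ ∧ sq κ σ β < 1 / ((j : ℝ) + 1) ∧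
      ∀ x, potential κ σ x ≤ potential κ ω x := fun j => exists_approx hκ hR1 hω hβ (by positivity)
  choose s h1 h2 h3 using this
  refine ⟨s, h1, ?_, h3⟩
  exact squeeze_zero (fun j => sq_nonneg' hR1.perfect.posdef (h1 j).1 hβ.1.1)
    (fun j => (h2 j).le) tendsto_one_div_add_atTop_nhds_zero_nat

lemma bal_bal (hκ : IsKernel κ) (hR1 : R1 κ) {A : Set X} {ω β ρ γ : Measure X}
    (hω : IsRadon ω) (hβ : IsInnerBalayage κ A ω β) (hρ : memE κ ρ)
    (hγ : IsInnerBalayage κ A ρ γ) : energy κ β ρ = energy κ β γ := by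
  have hp := hR1.perfect.posdef
  obtain ⟨s, hs, hlim, -⟩ := exists_seq hκ hR1 hω hβ
  have t1 := tendsto_en hκ hp (fun j => (hs j).1) hβ.1.1 hρ hlim
  have t2 := tendsto_en hκ hp (fun j => (hs j).1) hβ.1.1 hγ.1.1 hlim
  have : en κ β ρ = en κ β γ := by
    refine tendsto_nhds_unique t1 (t2.congr fun j => ?_)
    rw [en, en, energy_eq_of_bal hκ (hs j) hρ.1 hγ]
  exact (ENNReal.toReal_eq_toReal_iff' (energy_lt_top hp hβ.1.1 hρ).ne
    (energy_lt_top hp hβ.1.1 hγ.1.1).ne).1 this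

lemma bal_gen (hκ : IsKernel κ) (hR1 : R1 κ) {A : Set X} {ω β ρ γ : Measure X}
    (hω : IsRadon ω) (hβ : IsInnerBalayage κ A ω β) (hρ : memE κ ρ)
    (hγ : IsInnerBalayage κ A ρ γ) : energy κ γ β = energy κ γ ω := by
  have hp := hR1.perfect.posdef
  have hgb := energy_lt_top hp hγ.1.1 hβ.1.1
  apply le_antisymm
  · obtain ⟨s, hs, hlim, hle⟩ := exists_seq hκ hR1 hω hβ
    have t1 := tendsto_en hκ hp (fun j => (hs j).1) hβ.1.1 hγ.1.1 hlim
    have t2 : Tendsto (fun j => energy κ (s j) γ) atTop (𝓝 (energy κ β γ)) :=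
      (ENNReal.tendsto_toReal_iff (fun j => (energy_lt_top hp (hs j).1 hγ.1.1).ne)
        (energy_lt_top hp hβ.1.1 hγ.1.1).ne).1 t1
    rw [energy_comm hκ hγ.1.1.1 hβ.1.1.1]
    refine le_of_tendsto' t2 fun j => ?_
    rw [energy_comm hκ (hs j).1.1 hγ.1.1.1]
    exact lintegral_mono fun x => hle j x
  · obtain ⟨s, hs, hlim, -⟩ := exists_seq hκ hR1 hρ.1 hγ
    have hsE : ∀ j, memE κ (s j) := fun j => (hs j).1
    have hv := hR1.perfect.finerThanVague s γ hsE hγ.1.1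
      ((sDist_tendsto_iff hp hsE hγ.1.1).2 hlim)
    have t1 := tendsto_en hκ hp hsE hγ.1.1 hβ.1.1 hlim
    have t2 : Tendsto (fun j => energy κ (s j) β) atTop (𝓝 (energy κ γ β)) :=
      (ENNReal.tendsto_toReal_iff (fun j => (energy_lt_top hp (hsE j) hβ.1.1).ne) hgb.ne).1 t1
    have t3 : Tendsto (fun j => energy κ ω (s j)) atTop (𝓝 (energy κ γ β)) := by
      refine t2.congr fun j => ?_
      rw [energy_eq_of_bal hκ (hs j) hω hβ, energy_comm hκ (hsE j).1 hω]
    rw [energy_comm hκ hγ.1.1.1 hω, ← t3.liminf_eq]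
    calc energy κ ω γ ≤ ∫⁻ x, liminf (fun j => potential κ (s j) x) atTop ∂ω := by
          refine lintegral_mono fun x => ?_
          exact vague_lsc (fun j => (hsE j).1) hγ.1.1.1 hv
            (g := fun y => κ x y) (LowerSemicontinuous.comp (g := fun y : X => (x, y)) hκ.lsc (by fun_prop))
      _ ≤ _ := lintegral_liminf_le fun j => measurable_potential hκ (hsE j).1

end Aux

/-- The inner balayage is uniquely characterized within `E'(A)` by the
symmetry relation `I(ω^A, λ) = I(λ^A, ω)` for all `λ ∈ E⁺`. -/
theorem inner_balayage_symmetry_characterization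
    {X : Type*} [TopologicalSpace X] [T2Space X] [LocallyCompactSpace X]
    [SecondCountableTopology X] [MeasurableSpace X] [BorelSpace X]
    (κ : X → X → ℝ≥0∞) (hκ : IsKernel κ) (hR1 : R1 κ) (hR2 : R2 κ) (hR3 : R3 κ)
    (A : Set X) (hA : A ≠ Set.univ) (hcap : 0 < innerCap κ A)
    (ω : Measure X) (hωR : IsRadon ω) (hω0 : ω ≠ 0)
    (hfin : FiniteEnergy κ ω ∨ (ω A = 0 ∧ ω Set.univ < ⊤))
    (bal : Measure X → Measure X)
    (hbal : ∀ lam : Measure X, memE κ lam → IsInnerBalayage κ A lam (bal lam))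
    (ωA : Measure X) (hωA : IsInnerBalayage κ A ω ωA) :
    (∀ lam : Measure X, memE κ lam → energy κ ωA lam = energy κ (bal lam) ω) ∧
    (∀ μ : Measure X, memEClos κ A μ →
      (∀ lam : Measure X, memE κ lam → energy κ μ lam = energy κ (bal lam) ω) → μ = ωA) := by
  have hp := hR1.perfect.posdef
  have main : ∀ lam : Measure X, memE κ lam → energy κ ωA lam = energy κ (bal lam) ω := by
    intro lam hlam
    have hb := hbal lam hlam
    rw [bal_bal hκ hR1 hωR hωA hlam hb, energy_comm hκ hωA.1.1.1 hb.1.1.1,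
      bal_gen hκ hR1 hωR hωA hlam hb]
  refine ⟨main, fun μ hμ h => ?_⟩
  have h1 : energy κ μ μ = energy κ ωA μ := (h μ hμ.1).trans (main μ hμ.1).symm
  have h2 : energy κ μ ωA = energy κ ωA ωA := (h ωA hωA.1.1).trans (main ωA hωA.1.1).symm
  refine (hp μ ωA hμ.1.1 hωA.1.1.1 hμ.1.2 hωA.1.1.2).2 ?_
  rw [h1, ← h2, energy_comm hκ hωA.1.1.1 hμ.1.1, two_mul]

end Balayage
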